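/- Let n ≥ 1 and let A be an (n+1)×(n+1) real symmetric matrix with all diagonal entries equal to 1. Then A lies in the closure (in the space of (n+1)×(n+1) real matrices) of the set of positive definite symmetric matrices with all diagonal entries 1, if and only if either A is positive definite, or there exists a diagonal matrix D = diag(ε_1, ..., ε_{n+1}) with each ε_i = 1 or −1 such that DAD is of the form [v_i·v_j]_{1≤i,j≤n+1} for some unit vectors v_1, ..., v_{n+1} in R^n with a nonzero solution of ∑_{i=1}^{n+1} a_i v_i = 0 having all a_i ≥ 0. -/

import Mathlib

open RealInnerProductSpace

namespace Matrix

/-- The positive semidefinite matrices form a closed set. -/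
lemma isClosed_setOf_posSemidef {ι : Type*} [Fintype ι] :
    IsClosed {M : Matrix ι ι ℝ | M.PosSemidef} := by
  simp only [posSemidef_iff_dotProduct_mulVec, Set.ofPred_and, Set.ofPred_forall]
  refine IsClosed.inter ?_ (isClosed_iInter fun x => ?_)
  · exact isClosed_eq (by fun_prop) continuous_id
  · exact isClosed_le continuous_const (by fun_prop)

/-- Within the symmetric matrices with unit diagonal, the closure of the positive definite ones
consists of the positive semidefinite ones. -/
lemma mem_closure_unit_diag_posDef_iff {ι : Type*} [Fintype ι] [DecidableEq ι]
    {A : Matrix ι ι ℝ} (hsymm : A.IsSymm) (hdiag : ∀ i, A i i = 1) :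
    A ∈ closure {M : Matrix ι ι ℝ | M.IsSymm ∧ (∀ i, M i i = 1) ∧ M.PosDef} ↔
      A.PosSemidef := by
  constructor
  · exact fun h => closure_minimal (fun M hM => hM.2.2.posSemidef) isClosed_setOf_posSemidef h
  · intro hA
    have hcont : Continuous fun t : ℝ => (1 - t) • A + t • (1 : Matrix ι ι ℝ) := by fun_prop
    have htend := (hcont.tendsto 0).mono_left (nhdsWithin_le_nhds (s := Set.Ioi 0))
    simp only [sub_zero, one_smul, zero_smul, add_zero] at htend
    refine mem_closure_of_tendsto htend ?_
    filter_upwards [Ioo_mem_nhdsGT (zero_lt_one' ℝ)] with t ht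
    refine ⟨(hsymm.smul _).add (isSymm_one.smul _), fun i => by simp [hdiag], ?_⟩
    exact (PosDef.one.smul ht.1).posSemidef_add (hA.smul (sub_nonneg.2 ht.2.le))

/-- A singular positive semidefinite matrix of size `n + 1` is the Gram matrix of vectors of an
`n`-dimensional Euclidean space. -/
lemma PosSemidef.exists_gram_eq_of_det_eq_zero {n : ℕ}
    {A : Matrix (Fin (n + 1)) (Fin (n + 1)) ℝ} (hA : A.PosSemidef) (hdet : A.det = 0) :
    ∃ w : Fin (n + 1) → EuclideanSpace ℝ (Fin n), gram ℝ w = A := by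
  open scoped MatrixOrder in
  obtain ⟨B, rfl⟩ := CStarAlgebra.nonneg_iff_eq_star_mul_self.mp hA.nonneg
  have hB : B.det = 0 := by simpa [star_eq_conjTranspose] using hdet
  obtain ⟨y, hy, hyB⟩ := exists_vecMul_eq_zero_iff.2 hB
  have hu : WithLp.toLp 2 y ≠ 0 := by simpa using hy
  have hmem (i : Fin (n + 1)) : WithLp.toLp 2 (Bᵀ i) ∈ (ℝ ∙ WithLp.toLp 2 y)ᗮ := by
    rw [Submodule.mem_orthogonal_singleton_iff_inner_right]
    rw [EuclideanSpace.inner_eq_star_dotProduct, dotProduct_comm]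
    exact congrFun hyB i
  have : Fact (Module.finrank ℝ (EuclideanSpace ℝ (Fin (n + 1))) = n + 1) := ⟨by simp⟩
  refine ⟨fun i => (OrthonormalBasis.fromOrthogonalSpanSingleton n hu).repr ⟨_, hmem i⟩, ?_⟩
  ext i j
  simp [gram_apply, LinearIsometryEquiv.inner_map_map, EuclideanSpace.inner_eq_star_dotProduct,
    star_eq_conjTranspose, mul_apply, dotProduct, mul_comm]

/-- Conjugation by a diagonal sign matrix preserves and reflects positive semidefiniteness. -/
lemma posSemidef_diagonal_sign_conj_iff {ι : Type*} [Fintype ι] [DecidableEq ι]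
    {A : Matrix ι ι ℝ} {ε : ι → ℝ} (hε : ∀ i, ε i = 1 ∨ ε i = -1) :
    (diagonal ε * A * diagonal ε).PosSemidef ↔ A.PosSemidef := by
  have hsq : diagonal ε * diagonal ε = 1 := by
    rw [diagonal_mul_diagonal, ← diagonal_one]
    congr 1
    funext i
    rcases hε i with h | h <;> simp [h]
  have hunit : IsUnit (diagonal ε) := IsUnit.of_mul_eq_one _ hsq
  simpa [star_eq_conjTranspose] using IsUnit.posSemidef_star_left_conjugate_iff (x := A) hunit

end Matrix

/-- Theorem 3(b): a symmetric unidiagonal `(n+1)×(n+1)` matrix `A` lies in the closure of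
the set `X_{n+1}` of angle Gram matrices of spherical `n`-simplexes (the positive definite
symmetric unidiagonal matrices) iff either `A` is positive definite or `DAD` lies in the
closure of the set of Euclidean angle Gram matrices for some diagonal matrix `D` with
diagonal entries `±1`. -/
theorem mem_closure_spherical_gram_iff
    (n : ℕ) (hn : 1 ≤ n) (A : Matrix (Fin (n + 1)) (Fin (n + 1)) ℝ)
    (hsymm : A.IsSymm) (hdiag : ∀ i, A i i = 1) :
    A ∈ closure {M : Matrix (Fin (n + 1)) (Fin (n + 1)) ℝ |
        M.IsSymm ∧ (∀ i, M i i = 1) ∧ M.PosDef} ↔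
      (A.PosDef ∨
        ∃ ε : Fin (n + 1) → ℝ, (∀ i, ε i = 1 ∨ ε i = -1) ∧
          ∃ v : Fin (n + 1) → EuclideanSpace ℝ (Fin n),
            (∀ i, ‖v i‖ = 1) ∧
            (∃ a : Fin (n + 1) → ℝ, a ≠ 0 ∧ (∀ i, 0 ≤ a i) ∧ ∑ i, a i • v i = 0) ∧
            Matrix.diagonal ε * A * Matrix.diagonal ε =
              Matrix.of (fun i j => ⟪v i, v j⟫)) := by
  rw [Matrix.mem_closure_unit_diag_posDef_iff hsymm hdiag]
  constructor
  · intro hA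
    by_cases hpd : A.PosDef
    · exact Or.inl hpd
    have hdet : A.det = 0 := by
      by_contra h
      exact hpd (hA.posDef_iff_det_ne_zero.2 h)
    obtain ⟨w, rfl⟩ := hA.exists_gram_eq_of_det_eq_zero hdet
    obtain ⟨x, hx, hAx⟩ := Matrix.exists_mulVec_eq_zero_iff.2 hdet
    have hsum : ∑ i, x i • w i = 0 := by
      have h := Matrix.star_dotProduct_gram_mulVec (𝕜 := ℝ) w x x
      rw [hAx, dotProduct_zero] at h
      exact inner_self_eq_zero.1 h.symm
    have hε (i : Fin (n + 1)) :
        (if 0 ≤ x i then 1 else -1 : ℝ) = 1 ∨ (if 0 ≤ x i then 1 else -1 : ℝ) = -1 := by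
      split_ifs <;> simp
    have hw (i : Fin (n + 1)) : ‖w i‖ = 1 := by
      have h := hdiag i
      rw [Matrix.gram_apply, real_inner_self_eq_norm_sq] at h
      exact (pow_eq_one_iff_of_nonneg (norm_nonneg _) two_ne_zero).1 h
    refine Or.inr ⟨fun i => if 0 ≤ x i then 1 else -1, hε,
      fun i => (if 0 ≤ x i then 1 else -1 : ℝ) • w i, fun i => ?_,
      ⟨fun i => |x i|, ?_, fun i => abs_nonneg _, ?_⟩, ?_⟩
    · rcases hε i with h | h <;> simp [h, hw]
    · simpa [funext_iff] using hx
    · rw [← hsum]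
      refine Finset.sum_congr rfl fun i _ => ?_
      rw [smul_smul]
      beta_reduce
      split_ifs with h
      · rw [abs_of_nonneg h, mul_one]
      · rw [abs_of_neg (not_le.1 h), neg_mul_neg, mul_one]
    · ext i j
      simp only [Matrix.mul_diagonal, Matrix.diagonal_mul, Matrix.gram_apply, Matrix.of_apply,
        real_inner_smul_left, real_inner_smul_right]
      ring
  · rintro (hA | ⟨ε, hε, v, -, -, hv⟩)
    · exact hA.posSemidef
    · rw [← Matrix.posSemidef_diagonal_sign_conj_iff hε, hv]
      exact Matrix.posSemidef_gram ℝ v
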